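/- Let n and u be positive integers with u ≥ 2 and u | n. Then the family of all u-element subsets of an n-element set Ω can be partitioned into C(n−1, u−1) pairwise disjoint sub-families H_1, …, H_k such that each H_i consists of exactly n/u sets and each H_i is itself a partition of Ω (i.e., every vertex of Ω lies in exactly one set of H_i). -/

import Mathlib

open Finset in
/-- double counting with symmetry -/
theorem bar_sym {Ω : Type*} [Fintype Ω] [DecidableEq Ω] (u : ℕ) (L : Finset Ω) (a : Ω)
    (ha : a ∉ L) (Q : Finset Ω → Prop) [DecidablePred Q] :
    ∑ T ∈ (powersetCard u (univ : Finset Ω)).filter (fun T => Q (T ∩ L)), (T \ L).card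
      = Lᶜ.card * ((powersetCard u (univ : Finset Ω)).filter
          (fun T => Q (T ∩ L) ∧ a ∈ T)).card := by
  have h1 : ∀ T : Finset Ω, (T \ L).card = ∑ b ∈ Lᶜ, if b ∈ T then 1 else 0 := by
    intro T
    rw [← Finset.card_filter]
    congr 1
    ext x
    simp [and_comm]
  simp_rw [h1]
  rw [Finset.sum_comm]
  rw [← smul_eq_mul, ← Finset.sum_const]
  refine Finset.sum_congr rfl fun b hb => ?_
  rw [← Finset.card_filter, Finset.filter_filter]
  have hb' : b ∉ L := by simpa using hb
  have key : ∀ T : Finset Ω, (T.map (Equiv.swap a b).toEmbedding) ∩ L = T ∩ L := by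
    intro T
    ext x
    simp only [mem_inter, mem_map_equiv, Equiv.symm_swap, and_congr_left_iff]
    intro hx
    rw [Equiv.swap_apply_of_ne_of_ne]
    · rintro rfl; exact ha hx
    · rintro rfl; exact hb' hx
  refine Finset.card_bij' (fun T _ => T.map (Equiv.swap a b).toEmbedding)
    (fun T _ => T.map (Equiv.swap a b).toEmbedding) ?_ ?_ ?_ ?_
  · intro T hT
    simp only [mem_filter, mem_powersetCard, subset_univ, true_and, key, card_map] at hT ⊢
    refine ⟨hT.1, hT.2.1, ?_⟩
    simpa [mem_map_equiv] using hT.2.2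
  · intro T hT
    simp only [mem_filter, mem_powersetCard, subset_univ, true_and, key, card_map] at hT ⊢
    refine ⟨hT.1, hT.2.1, ?_⟩
    simpa [mem_map_equiv] using hT.2.2
  · intro T _
    ext x
    simp [mem_map_equiv]
  · intro T _
    ext x
    simp [mem_map_equiv]

open Finset in
theorem bar_card {Ω : Type*} [Fintype Ω] [DecidableEq Ω] (n u : ℕ)
    (hΩ : Fintype.card Ω = n) (hn : 0 < n) (hu : 2 ≤ u) (a : Ω) :
    ((powersetCard u (univ : Finset Ω)).filter (fun T => a ∈ T)).card
      = (n - 1).choose (u - 1) := by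
  have h := bar_sym u (∅ : Finset Ω) a (by simp) (fun _ => True)
  simp only [filter_true, sdiff_empty, true_and, compl_empty, card_univ, hΩ] at h
  rw [Finset.sum_congr rfl (fun T hT => (mem_powersetCard.1 hT).2), Finset.sum_const,
    card_powersetCard, card_univ, hΩ, smul_eq_mul] at h
  obtain ⟨k, rfl⟩ : ∃ k, n = k + 1 := ⟨n - 1, by omega⟩
  obtain ⟨v, rfl⟩ : ∃ k, u = k + 1 := ⟨u - 1, by omega⟩
  rw [← Nat.add_one_mul_choose_eq] at h
  simpa using (Nat.eq_of_mul_eq_mul_left (Nat.succ_pos k) h).symm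

open Finset in
theorem bar_step {Ω : Type*} [Fintype Ω] [DecidableEq Ω] (u m M : ℕ)
    (hm : m * u = Fintype.card Ω) (L : Finset Ω) (a : Ω) (ha : a ∉ L)
    (hM : ((powersetCard u (univ : Finset Ω)).filter (fun T => a ∈ T)).card = M)
    (g : Fin M → Ω → Fin m)
    (hg : ∀ S : Finset Ω, (univ.filter (fun p : Fin M × Fin m =>
        L.filter (fun x => g p.1 x = p.2) = S)).card
      = ((powersetCard u (univ : Finset Ω)).filter (fun T => T ∩ L = S)).card) :
    ∃ g' : Fin M → Ω → Fin m, ∀ S : Finset Ω, (univ.filter (fun p : Fin M × Fin m =>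
        (insert a L).filter (fun x => g' p.1 x = p.2) = S)).card
      = ((powersetCard u (univ : Finset Ω)).filter (fun T => T ∩ (insert a L) = S)).card := by
  classical
  set P : Fin M → Fin m → Finset Ω := fun i j => L.filter (fun x => g i x = j) with hP
  set U := powersetCard u (univ : Finset Ω) with hU
  let N : Fin M → Finset (Finset Ω) := fun i =>
    U.filter (fun T => (∃ j, P i j = T ∩ L) ∧ a ∈ T)
  have hle : ∀ i j, (P i j).card ≤ u := by
    intro i j
    have h : 0 < (univ.filter (fun p : Fin M × Fin m =>
        L.filter (fun x => g p.1 x = p.2) = P i j)).card :=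
      card_pos.2 ⟨(i, j), by simp [hP]⟩
    rw [hg, card_pos] at h
    obtain ⟨T, hT⟩ := h
    simp only [hU, mem_filter, mem_powersetCard] at hT
    rw [← hT.2, ← hT.1.2]
    exact card_le_card inter_subset_left
  have hsum : ∀ i, ∑ j, (u - (P i j).card) = Lᶜ.card := by
    intro i
    have h1 : ∑ j, (u - (P i j).card) + ∑ j, (P i j).card = m * u := by
      rw [← Finset.sum_add_distrib, Finset.sum_congr rfl
        (fun j _ => Nat.sub_add_cancel (hle i j))]
      simp
    have h2 : ∑ j, (P i j).card = L.card :=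
      (Finset.card_eq_sum_card_fiberwise (f := g i) (t := univ) (by simp)).symm
    rw [card_compl]
    omega
  have hr : 0 < Lᶜ.card := card_pos.2 ⟨a, by simpa using ha⟩
  have hall : ∀ X : Finset (Fin M), X.card ≤ (X.biUnion N).card := by
    intro X
    refine Nat.le_of_mul_le_mul_left ?_ hr
    let 𝒮 : Finset (Finset Ω) := (X ×ˢ univ).image (fun p : Fin M × Fin m => P p.1 p.2)
    have e1 : X.biUnion N = U.filter (fun T => T ∩ L ∈ 𝒮 ∧ a ∈ T) := by
      ext T
      simp only [N, 𝒮, mem_biUnion, mem_filter, mem_image, mem_product, mem_univ, and_true,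
        Prod.exists]
      tauto
    rw [e1, ← bar_sym u L a ha (fun S => S ∈ 𝒮)]
    have e2 : Lᶜ.card * X.card = ∑ p ∈ X ×ˢ (univ : Finset (Fin m)), (u - (P p.1 p.2).card) := by
      rw [Finset.sum_product, Finset.sum_congr rfl (fun i _ => hsum i)]
      simp [mul_comm]
    rw [e2]
    have e3 : ∑ T ∈ U.filter (fun T => T ∩ L ∈ 𝒮), (T \ L).card
        = ∑ S ∈ 𝒮, (U.filter (fun T => T ∩ L = S)).card * (u - S.card) := by
      rw [← Finset.sum_fiberwise_of_maps_to (t := 𝒮) (g := fun T => T ∩ L)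
        (fun T hT => (mem_filter.1 hT).2)]
      refine Finset.sum_congr rfl fun S hS => ?_
      rw [← smul_eq_mul, ← Finset.sum_const]
      refine Finset.sum_congr ?_ ?_
      · ext T
        simp only [mem_filter]
        constructor
        · rintro ⟨⟨h1, h2⟩, h3⟩; exact ⟨h1, h3⟩
        · rintro ⟨h1, h3⟩; exact ⟨⟨h1, h3 ▸ hS⟩, h3⟩
      · intro T hT
        simp only [hU, mem_filter, mem_powersetCard] at hT
        have := card_sdiff_add_card_inter T L
        rw [hT.2, hT.1.2] at this
        omega
    rw [e3, ← Finset.sum_fiberwise_of_maps_to (t := 𝒮)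
      (g := fun p : Fin M × Fin m => P p.1 p.2) (fun p hp => mem_image_of_mem _ hp)]
    refine Finset.sum_le_sum fun S hS => ?_
    rw [Finset.sum_congr rfl (g := fun _ => u - S.card)
      (fun p hp => by rw [(mem_filter.1 hp).2]), Finset.sum_const, smul_eq_mul, ← hg]
    refine Nat.mul_le_mul_right _ (card_le_card ?_)
    intro p hp
    simpa using (mem_filter.1 hp).2
  obtain ⟨f, finj, hf⟩ := (Finset.all_card_le_biUnion_card_iff_exists_injective N).1 hall
  have hf' : ∀ i, f i ∈ U ∧ (∃ j, P i j = f i ∩ L) ∧ a ∈ f i := fun i => by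
    simpa [N] using hf i
  choose J hJ using fun i => (hf' i).2.1
  have himg : univ.image f = U.filter (fun T => a ∈ T) := by
    refine Finset.eq_of_subset_of_card_le ?_ ?_
    · intro T hT
      obtain ⟨i, -, rfl⟩ := mem_image.1 hT
      exact mem_filter.2 ⟨(hf' i).1, (hf' i).2.2⟩
    · rw [hM, card_image_of_injective _ finj]; simp
  have hcnt : ∀ S, (univ.filter (fun i => P i (J i) = S)).card
      = (U.filter (fun T => T ∩ L = S ∧ a ∈ T)).card := by
    intro S
    have : U.filter (fun T => T ∩ L = S ∧ a ∈ T)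
        = (univ.filter (fun i => P i (J i) = S)).image f := by
      ext T
      have hT : T ∈ univ.image f ↔ T ∈ U.filter (fun T => a ∈ T) := by rw [himg]
      simp only [mem_filter, mem_image, mem_univ, true_and] at hT ⊢
      constructor
      · rintro ⟨h1, h2, h3⟩
        obtain ⟨i, rfl⟩ := hT.2 ⟨h1, h3⟩
        exact ⟨i, by rw [hJ, h2], rfl⟩
      · rintro ⟨i, h, rfl⟩
        exact ⟨(hf' i).1, by rw [← hJ, h], (hf' i).2.2⟩
    rw [this, card_image_of_injective _ finj]
  have hcnt2 : ∀ S, (univ.filter (fun p : Fin M × Fin m => P p.1 p.2 = S ∧ p.2 = J p.1)).card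
      = (U.filter (fun T => T ∩ L = S ∧ a ∈ T)).card := by
    intro S
    rw [← hcnt]
    symm
    refine Finset.card_bij (fun i _ => (i, J i)) ?_ ?_ ?_
    · intro i hi; simpa using hi
    · intro i _ j _ h; exact (Prod.ext_iff.1 h).1
    · rintro ⟨i, j⟩ h
      simp only [mem_filter, mem_univ, true_and] at h
      obtain ⟨h1, rfl⟩ := h
      exact ⟨i, by simpa using h1, rfl⟩
  refine ⟨fun i => Function.update (g i) a (J i), fun S => ?_⟩
  have hP' : ∀ i j, (insert a L).filter (fun x => Function.update (g i) a (J i) x = j)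
      = if j = J i then insert a (P i j) else P i j := by
    intro i j
    have hL : L.filter (fun x => Function.update (g i) a (J i) x = j) = P i j := by
      refine Finset.filter_congr fun x hx => ?_
      rw [Function.update_of_ne]
      rintro rfl; exact ha hx
    rw [Finset.filter_insert, hL, Function.update_self]
    simp only [eq_comm]
  simp only [hP']
  have haP : ∀ i j, a ∉ P i j := fun i j h => ha (mem_filter.1 h).1
  by_cases haS : a ∈ S
  · have l1 : (univ.filter (fun p : Fin M × Fin m =>
        (if p.2 = J p.1 then insert a (P p.1 p.2) else P p.1 p.2) = S))
        = univ.filter (fun p : Fin M × Fin m => P p.1 p.2 = S.erase a ∧ p.2 = J p.1) := by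
      refine Finset.filter_congr fun p _ => ?_
      split_ifs with h
      · simp only [h, and_true]
        constructor
        · rintro rfl; rw [erase_insert (haP _ _)]
        · intro h; rw [h, insert_erase haS]
      · simp only [h, and_false, iff_false]
        rintro rfl; exact haP _ _ haS
    rw [l1, hcnt2]
    congr 1
    refine Finset.filter_congr fun T _ => ?_
    constructor
    · rintro ⟨h1, h2⟩
      rw [inter_insert_of_mem h2, h1, insert_erase haS]
    · rintro rfl
      have h2 : a ∈ T := (mem_inter.1 haS).1
      refine ⟨?_, h2⟩
      rw [inter_insert_of_mem h2, erase_insert]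
      simp [ha]
  · have l1 : (univ.filter (fun p : Fin M × Fin m =>
        (if p.2 = J p.1 then insert a (P p.1 p.2) else P p.1 p.2) = S))
        = univ.filter (fun p : Fin M × Fin m => P p.1 p.2 = S ∧ ¬ p.2 = J p.1) := by
      refine Finset.filter_congr fun p _ => ?_
      split_ifs with h
      · simp only [h, not_true, and_false, iff_false]
        rintro rfl; exact haS (mem_insert_self _ _)
      · simp [h]
    have l2 : U.filter (fun T => T ∩ (insert a L) = S)
        = U.filter (fun T => T ∩ L = S ∧ ¬ a ∈ T) := by
      refine Finset.filter_congr fun T _ => ?_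
      by_cases h : a ∈ T
      · simp only [h, not_true, and_false, iff_false]
        rintro rfl; exact haS (by simp [h])
      · rw [inter_insert_of_notMem h]; simp [h]
    rw [l1, l2]
    have c1 := Finset.card_filter_add_card_filter_not
      (s := univ.filter (fun p : Fin M × Fin m => P p.1 p.2 = S)) (fun p => p.2 = J p.1)
    have c2 := Finset.card_filter_add_card_filter_not
      (s := U.filter (fun T => T ∩ L = S)) (fun T => a ∈ T)
    rw [Finset.filter_filter, Finset.filter_filter] at c1 c2
    have c3 := hcnt2 S
    have c4 : (univ.filter (fun p : Fin M × Fin m => P p.1 p.2 = S)).card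
      = (U.filter (fun T => T ∩ L = S)).card := hg S
    omega

/-- **Corollary of Baranyai's theorem.** If `u ≥ 2`, `u ∣ n`, `n > 0`, then the family of
all `u`-element subsets of an `n`-element set `Ω` can be partitioned into
`C(n−1, u−1)` pairwise disjoint sub-families `H₁, …, H_k` such that each `Hᵢ`
consists of exactly `n/u` sets and each `Hᵢ` is itself a partition of `Ω`
(every vertex of `Ω` lies in exactly one set of `Hᵢ`). -/
theorem baranyai_corollary (Ω : Type*) [Fintype Ω] [DecidableEq Ω] (n u : ℕ)
    (hΩ : Fintype.card Ω = n) (hn : 0 < n) (hu : 2 ≤ u) (hdvd : u ∣ n) :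
    ∃ H : Fin ((n - 1).choose (u - 1)) → Finset (Finset Ω),
      (∀ i j, i ≠ j → Disjoint (H i) (H j)) ∧
      (Finset.univ.biUnion H = Finset.powersetCard u (Finset.univ : Finset Ω)) ∧
      (∀ i, (H i).card = n / u) ∧
      (∀ i, ∀ ω : Ω, ((H i).filter (fun E => ω ∈ E)).card = 1) := by
  obtain ⟨m, hm⟩ := hdvd
  have hm0 : 0 < m := Nat.pos_of_ne_zero (by rintro rfl; omega)
  have hdiv : n / u = m := by rw [hm]; exact Nat.mul_div_cancel_left _ (by omega)
  have hchoose : (n - 1).choose (u - 1) * m = n.choose u := by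
    obtain ⟨k, hk⟩ : ∃ k, n = k + 1 := ⟨n - 1, by omega⟩
    obtain ⟨v, hv⟩ : ∃ k, u = k + 1 := ⟨u - 1, by omega⟩
    have h := Nat.add_one_mul_choose_eq k v
    rw [← hk, ← hv] at h
    have h' : k = n - 1 := by omega
    have h'' : v = u - 1 := by omega
    subst h' h''
    refine Nat.eq_of_mul_eq_mul_right (show 0 < u by omega) ?_
    rw [← h]
    calc (n - 1).choose (u - 1) * m * u = (u * m) * (n - 1).choose (u - 1) := by ring
      _ = n * (n - 1).choose (u - 1) := by rw [← hm]
  have main : ∀ L : Finset Ω, ∃ g : Fin ((n - 1).choose (u - 1)) → Ω → Fin m,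
      ∀ S : Finset Ω, (Finset.univ.filter
        (fun p : Fin ((n - 1).choose (u - 1)) × Fin m =>
        L.filter (fun x => g p.1 x = p.2) = S)).card
      = ((Finset.powersetCard u (Finset.univ : Finset Ω)).filter (fun T => T ∩ L = S)).card := by
    intro L
    induction L using Finset.induction_on with
    | empty =>
      refine ⟨fun _ _ => ⟨0, hm0⟩, fun S => ?_⟩
      by_cases hS : ∅ = S
      · subst hS
        simp [hΩ, hchoose]
      · simp [hS]
    | insert a L ha ih =>
      obtain ⟨g, hg⟩ := ih
      exact bar_step u m _ (by rw [hΩ, hm, mul_comm]) L a ha (bar_card n u hΩ hn hu a) g hg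
  obtain ⟨g, hg⟩ := main Finset.univ
  simp only [Finset.inter_univ] at hg
  have hcard : ∀ i j, (Finset.univ.filter (fun x => g i x = j)).card = u := by
    intro i j
    have h : 0 < (Finset.univ.filter (fun p : Fin ((n - 1).choose (u - 1)) × Fin m =>
        Finset.univ.filter (fun x => g p.1 x = p.2)
          = Finset.univ.filter (fun x => g i x = j))).card :=
      Finset.card_pos.2 ⟨(i, j), by simp⟩
    rw [hg, Finset.card_pos] at h
    obtain ⟨T, hT⟩ := h
    simp only [Finset.mem_filter, Finset.mem_powersetCard] at hT
    rw [← hT.2, hT.1.2]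
  have hone : ∀ S : Finset Ω, S.card = u →
      (Finset.univ.filter (fun p : Fin ((n - 1).choose (u - 1)) × Fin m =>
        Finset.univ.filter (fun x => g p.1 x = p.2) = S)).card = 1 := by
    intro S hS
    rw [hg, Finset.filter_eq']
    simp [hS]
  have hinj : ∀ i j i' j', Finset.univ.filter (fun x => g i x = j)
      = Finset.univ.filter (fun x => g i' x = j') → i = i' ∧ j = j' := by
    intro i j i' j' h
    have h1 := (Finset.card_le_one.1 (hone _ (hcard i' j')).le) (i, j) (by simpa using h)
      (i', j') (by simp)
    exact Prod.ext_iff.1 h1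
  refine ⟨fun i => Finset.univ.image (fun j => Finset.univ.filter (fun x => g i x = j)),
    ?_, ?_, ?_, ?_⟩
  · intro i i' hne
    rw [Finset.disjoint_left]
    intro T h1 h2
    obtain ⟨j, -, rfl⟩ := Finset.mem_image.1 h1
    obtain ⟨j', -, h⟩ := Finset.mem_image.1 h2
    exact hne (hinj _ _ _ _ h).1.symm
  · ext T
    simp only [Finset.mem_biUnion, Finset.mem_univ, true_and, Finset.mem_image,
      Finset.mem_powersetCard, Finset.subset_univ]
    constructor
    · rintro ⟨i, j, rfl⟩; exact hcard i j
    · intro hT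
      obtain ⟨p, hp⟩ := Finset.card_pos.1 (by rw [hone T hT]; exact one_pos)
      exact ⟨p.1, p.2, by simpa using hp⟩
  · intro i
    rw [Finset.card_image_of_injective _ (fun j j' h => (hinj _ _ _ _ h).2), hdiv]
    simp
  · intro i ω
    rw [Finset.card_eq_one]
    refine ⟨Finset.univ.filter (fun x => g i x = g i ω), ?_⟩
    ext T
    simp only [Finset.mem_filter, Finset.mem_image, Finset.mem_univ, true_and,
      Finset.mem_singleton]
    constructor
    · rintro ⟨⟨j, rfl⟩, h⟩
      have : g i ω = j := by simpa using h
      rw [this]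
    · rintro rfl
      exact ⟨⟨_, rfl⟩, by simp⟩
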